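/- arXiv:1603.09363 — 2 statements merged into one kernel-verified Lean document; each statement's English description precedes it below -/
import Mathlib

section
/- Let a, b, K₀ > 0 and k > 1/π satisfy (a·K₀·k)² − 4·b·K₀·k > 0, and define λ₁, λ₂, c₁, c₂ and θ(t) = c₁·e^{λ₁ t} + c₂·e^{λ₂ t} as follows: λ₁ = (−a·K₀·k + √((a·K₀·k)² − 4·b·K₀·k))/2, λ₂ = (−a·K₀·k − √((a·K₀·k)² − 4·b·K₀·k))/2, c₁ = (√((a·K₀)² + 4·b·K₀·(π − 1/k))/√((a·K₀)² − 4·b·K₀/k) + 1)/(2k), c₂ = (1 − √((a·K₀)² + 4·b·K₀·(π − 1/k))/√((a·K₀)² − 4·b·K₀/k))/(2k). Then c₁ > 0 > c₂, and for t₀ = ln(−c₂/c₁)/√((a·K₀·k)² − 4·b·K₀·k) one has θ(t₀) = 0 and θ′(t₀) = c₁·√((a·K₀·k)² − 4·b·K₀·k)·(−c₂/c₁)^{1/2 − a·K₀·k/(2·√((a·K₀·k)² − 4·b·K₀·k))}. -/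
/-- A sum of two exponentials with coefficients of opposite signs vanishes at
`ln(-c₂/c₁)/(l₁ - l₂)`, and its derivative there is
`c₁ (l₁ - l₂) (-c₂/c₁)^{l₁/(l₁ - l₂)}`. -/
theorem two_exp_zero_and_hasDerivAt {c₁ c₂ l₁ l₂ s t : ℝ} (hc₁ : 0 < c₁) (hc₂ : c₂ < 0)
    (hs : s ≠ 0) (hl : l₁ - l₂ = s) (ht : t = Real.log (-c₂ / c₁) / s) :
    c₁ * Real.exp (l₁ * t) + c₂ * Real.exp (l₂ * t) = 0 ∧
    HasDerivAt (fun u => c₁ * Real.exp (l₁ * u) + c₂ * Real.exp (l₂ * u))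
      (c₁ * s * (-c₂ / c₁) ^ (l₁ / s)) t := by
  have hr : 0 < -c₂ / c₁ := div_pos (neg_pos.mpr hc₂) hc₁
  have hst : s * t = Real.log (-c₂ / c₁) := by rw [ht]; field_simp
  have hexp : Real.exp (l₁ * t) = -c₂ / c₁ * Real.exp (l₂ * t) := by
    rw [show l₁ * t = s * t + l₂ * t by rw [← hl]; ring, Real.exp_add, hst, Real.exp_log hr]
  have hzero : c₁ * Real.exp (l₁ * t) + c₂ * Real.exp (l₂ * t) = 0 := by
    rw [hexp]; field_simp; ring
  have hpow : (-c₂ / c₁) ^ (l₁ / s) = Real.exp (l₁ * t) := by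
    rw [Real.rpow_def_of_pos hr, ht]; congr 1; ring
  refine ⟨hzero, ?_⟩
  have hderiv (c l : ℝ) :
      HasDerivAt (fun u => c * Real.exp (l * u)) (c * (Real.exp (l * t) * l)) t := by
    simpa using (((hasDerivAt_id t).const_mul l).exp).const_mul c
  refine ((hderiv c₁ l₁).add (hderiv c₂ l₂)).congr_deriv ?_
  rw [hpow, ← hl]
  linear_combination l₂ * hzero

/-- Stable-node case: for the separatrix solution
`θ(t) = c₁·e^{λ₁t} + c₂·e^{λ₂t}` one has `c₁ > 0 > c₂`, and at
`t₀ = ln(−c₂/c₁)/√((aK₀k)² − 4bK₀k)` it holds that `θ(t₀) = 0` and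
`θ′(t₀) = c₁·√((aK₀k)² − 4bK₀k)·(−c₂/c₁)^{1/2 − aK₀k/(2√((aK₀k)² − 4bK₀k))}`. -/
theorem pll_node_lock_in_value
    (a b K₀ k : ℝ) (ha : 0 < a) (hb : 0 < b) (hK₀ : 0 < K₀)
    (hk : 1 / Real.pi < k)
    (hD : (a * K₀ * k) ^ 2 - 4 * b * K₀ * k > 0)
    (lam₁ lam₂ c₁ c₂ t₀ : ℝ)
    (hlam₁ : lam₁ = (-(a * K₀ * k) + Real.sqrt ((a * K₀ * k) ^ 2 - 4 * b * K₀ * k)) / 2)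
    (hlam₂ : lam₂ = (-(a * K₀ * k) - Real.sqrt ((a * K₀ * k) ^ 2 - 4 * b * K₀ * k)) / 2)
    (hc₁ : c₁ = (Real.sqrt ((a * K₀) ^ 2 + 4 * b * K₀ * (Real.pi - 1 / k)) /
        Real.sqrt ((a * K₀) ^ 2 - 4 * b * K₀ / k) + 1) / (2 * k))
    (hc₂ : c₂ = (1 - Real.sqrt ((a * K₀) ^ 2 + 4 * b * K₀ * (Real.pi - 1 / k)) /
        Real.sqrt ((a * K₀) ^ 2 - 4 * b * K₀ / k)) / (2 * k))
    (ht₀ : t₀ = Real.log (-c₂ / c₁) / Real.sqrt ((a * K₀ * k) ^ 2 - 4 * b * K₀ * k))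
    (θ : ℝ → ℝ)
    (hθ : θ = fun t => c₁ * Real.exp (lam₁ * t) + c₂ * Real.exp (lam₂ * t)) :
    c₁ > 0 ∧ 0 > c₂ ∧ θ t₀ = 0 ∧
    deriv θ t₀ =
      c₁ * Real.sqrt ((a * K₀ * k) ^ 2 - 4 * b * K₀ * k) *
        Real.rpow (-c₂ / c₁)
          (1 / 2 - a * K₀ * k / (2 * Real.sqrt ((a * K₀ * k) ^ 2 - 4 * b * K₀ * k))) := by
  have hk₀ : 0 < k := (one_div_pos.mpr Real.pi_pos).trans hk
  have hs : 0 < Real.sqrt ((a * K₀ * k) ^ 2 - 4 * b * K₀ * k) := Real.sqrt_pos.mpr hD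
  have hB : 0 < (a * K₀) ^ 2 - 4 * b * K₀ / k := by
    have h : (a * K₀) ^ 2 - 4 * b * K₀ / k =
        ((a * K₀ * k) ^ 2 - 4 * b * K₀ * k) / k ^ 2 := by
      field_simp
    rw [h]
    exact div_pos hD (by positivity)
  have hlt : (a * K₀) ^ 2 - 4 * b * K₀ / k <
      (a * K₀) ^ 2 + 4 * b * K₀ * (Real.pi - 1 / k) := by
    have h : 0 < 4 * b * K₀ * Real.pi := by positivity
    linear_combination h
  have hratio : 1 < Real.sqrt ((a * K₀) ^ 2 + 4 * b * K₀ * (Real.pi - 1 / k)) /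
      Real.sqrt ((a * K₀) ^ 2 - 4 * b * K₀ / k) :=
    (one_lt_div (Real.sqrt_pos.mpr hB)).mpr (Real.sqrt_lt_sqrt hB.le hlt)
  have hc₁_pos : 0 < c₁ := by rw [hc₁]; positivity
  have hc₂_neg : c₂ < 0 := by
    rw [hc₂]
    exact div_neg_of_neg_of_pos (by linarith) (by positivity)
  obtain ⟨hzero, hderiv⟩ := two_exp_zero_and_hasDerivAt (l₁ := lam₁) (l₂ := lam₂)
    hc₁_pos hc₂_neg hs.ne' (by rw [hlam₁, hlam₂]; ring) ht₀
  have hexponent : lam₁ / Real.sqrt ((a * K₀ * k) ^ 2 - 4 * b * K₀ * k) =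
      1 / 2 - a * K₀ * k / (2 * Real.sqrt ((a * K₀ * k) ^ 2 - 4 * b * K₀ * k)) := by
    rw [hlam₁]
    generalize Real.sqrt ((a * K₀ * k) ^ 2 - 4 * b * K₀ * k) = s at hs
    field_simp
    ring
  subst hθ
  refine ⟨hc₁_pos, hc₂_neg, hzero, ?_⟩
  rw [hderiv.deriv, hexponent]
  rfl
end

section
/- Let a, b, K₀ > 0 and k > 1/π satisfy (a·K₀·k)² − 4·b·K₀·k = 0, and set c₂ = √((a·K₀)² + 4·b·K₀·(π − 1/k))/2, c₁ = 1/k − c₂, and θ(t) = e^{−(a·K₀·k/2)·t}·(c₁ + c₂·(t + 1)). Then c₂ > 0, and for t₀ = −1/(c₂·k) one has θ(t₀) = 0 and θ′(t₀) = c₂·e^{a·K₀/(2·c₂)}. -/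
/-- Stable degenerated-node case: for the separatrix solution
`θ(t) = e^{−(aK₀k/2)t}·(c₁ + c₂(t + 1))` one has `c₂ > 0`, and at
`t₀ = −1/(c₂k)` it holds that `θ(t₀) = 0` and `θ′(t₀) = c₂·e^{aK₀/(2c₂)}`. -/
theorem pll_degenerated_node_lock_in_value
    (a b K₀ k : ℝ) (ha : 0 < a) (hb : 0 < b) (hK₀ : 0 < K₀)
    (hk : 1 / Real.pi < k)
    (hD : (a * K₀ * k) ^ 2 - 4 * b * K₀ * k = 0)
    (c₁ c₂ t₀ : ℝ)
    (hc₂ : c₂ = Real.sqrt ((a * K₀) ^ 2 + 4 * b * K₀ * (Real.pi - 1 / k)) / 2)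
    (hc₁ : c₁ = 1 / k - c₂)
    (ht₀ : t₀ = -1 / (c₂ * k))
    (θ : ℝ → ℝ)
    (hθ : θ = fun t => Real.exp (-(a * K₀ * k / 2) * t) * (c₁ + c₂ * (t + 1))) :
    0 < c₂ ∧ θ t₀ = 0 ∧ deriv θ t₀ = c₂ * Real.exp (a * K₀ / (2 * c₂)) := by
  have hk0 : 0 < k := lt_trans (by positivity) hk
  have hpi : 0 < Real.pi - 1 / k := by
    have : 1 / k < Real.pi := (one_div_lt Real.pi_pos hk0).mp hk
    linarith
  have hc : 0 < c₂ := by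
    rw [hc₂]
    positivity
  have hzero : c₁ + c₂ * (t₀ + 1) = 0 := by
    rw [hc₁, ht₀]
    field_simp
    ring
  have hexp : -(a * K₀ * k / 2) * t₀ = a * K₀ / (2 * c₂) := by
    rw [ht₀]
    field_simp
  refine ⟨hc, by simp only [hθ, hzero, mul_zero], ?_⟩
  have hd₁ : HasDerivAt (fun t => Real.exp (-(a * K₀ * k / 2) * t))
      (Real.exp (-(a * K₀ * k / 2) * t₀) * (-(a * K₀ * k / 2) * 1)) t₀ :=
    ((hasDerivAt_id t₀).const_mul _).exp
  have hd₂ : HasDerivAt (fun t => c₁ + c₂ * (t + 1)) (c₂ * 1) t₀ :=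
    (((hasDerivAt_id t₀).add_const 1).const_mul c₂).const_add c₁
  rw [hθ, (hd₁.fun_mul hd₂).deriv, hzero, hexp]
  ring
end
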